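/- arXiv:math/9909141 — 2 statements merged into one kernel-verified Lean document; each statement's English description precedes it below -/
import Mathlib

section
/- Σ_{a, b ≥ 1} 1/(a·b·(a+b))^4 = 19·(2π)^{12}/(180 · 13!), where the sum ranges over all pairs of positive integers (a, b) and converges absolutely. -/
open MeasureTheory

theorem bernoulliFun_four (x : ℝ) : bernoulliFun 4 x = x ^ 4 - 2 * x ^ 3 + x ^ 2 - 1 / 30 := by
  have h3 : bernoulli 3 = 0 := bernoulli_eq_zero_of_odd (by decide) (by norm_num)
  have h4 : bernoulli 4 = -1 / 30 := by
    rw [bernoulli_eq_bernoulli'_of_ne_one (by norm_num), bernoulli'_four]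
  simp [bernoulliFun, Polynomial.bernoulli_def, Finset.sum_range_succ, h3, h4, Nat.choose]
  ring

theorem integral_bernoulliFun_four_pow_three :
    ∫ x in (0 : ℝ)..1, bernoulliFun 4 x ^ 3 =
      -(6 * 19 * 24 ^ 3 / (180 * (Nat.factorial 13 : ℝ))) := by
  have hF (x : ℝ) : HasDerivAt (fun x : ℝ =>
      x ^ 7 / 7 - 6 * (x ^ 8 / 8) + 15 * (x ^ 9 / 9) - 20 * (x ^ 10 / 10) + 15 * (x ^ 11 / 11)
        - 6 * (x ^ 12 / 12) + x ^ 13 / 13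
      - (x ^ 5 / 5 - 4 * (x ^ 6 / 6) + 6 * (x ^ 7 / 7) - 4 * (x ^ 8 / 8) + x ^ 9 / 9) / 10
      + (x ^ 5 / 5 - 2 * (x ^ 4 / 4) + x ^ 3 / 3) / 300 - x / 27000) (bernoulliFun 4 x ^ 3) x := by
    rw [bernoulliFun_four]
    have hp (n : ℕ) := hasDerivAt_pow n x
    refine ((((((((((((hp 7).div_const 7).sub (((hp 8).div_const 8).const_mul 6)).add
      (((hp 9).div_const 9).const_mul 15)).sub (((hp 10).div_const 10).const_mul 20)).add
      (((hp 11).div_const 11).const_mul 15)).sub (((hp 12).div_const 12).const_mul 6)).add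
      ((hp 13).div_const 13)).sub
      (((((((hp 5).div_const 5).sub (((hp 6).div_const 6).const_mul 4)).add
      (((hp 7).div_const 7).const_mul 6)).sub (((hp 8).div_const 8).const_mul 4)).add
      ((hp 9).div_const 9)).div_const 10)).add
      (((((hp 5).div_const 5).sub (((hp 4).div_const 4).const_mul 2)).add
      ((hp 3).div_const 3)).div_const 300)).sub ((hasDerivAt_id x).div_const 27000))).congr_deriv ?_
    norm_num
    ring
  rw [intervalIntegral.integral_eq_sub_of_hasDerivAt (fun x _ => hF x)
    (((continuous_bernoulliFun 4).pow 3).intervalIntegrable _ _)]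
  norm_num [Nat.factorial]

theorem summable_norm_one_div_int_pow {k : ℕ} (hk : 2 ≤ k) :
    Summable fun n : ℤ => ‖1 / (n : ℂ) ^ k‖ := by
  have : (fun n : ℤ => ‖1 / (n : ℂ) ^ k‖) = fun n : ℤ => |1 / (n : ℝ) ^ k| := by
    ext1 n
    simp only [one_div, norm_inv, norm_pow, Complex.norm_intCast, pow_abs, abs_inv]
  rw [this, summable_abs_iff, Real.summable_one_div_int_pow]
  exact hk

theorem norm_fourier_apply {T : ℝ} (n : ℤ) (x : AddCircle T) : ‖fourier n x‖ = 1 :=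
  Circle.norm_coe _

theorem integral_fourier_mul_bernoulliFun {k : ℕ} (hk : k ≠ 0) (n : ℤ) :
    ∫ x in (0 : ℝ)..1, fourier n (x : UnitAddCircle) * (bernoulliFun k x : ℂ) =
      -(Nat.factorial k : ℂ) / (2 * Real.pi * Complex.I * (-n : ℤ)) ^ k := by
  rw [← bernoulliFourierCoeff_eq hk, bernoulliFourierCoeff, fourierCoeffOn_eq_integral]
  simp

/-- Integrating the cube of the Fourier series of `Bₖ` termwise. -/
theorem hasSum_integral_bernoulliFun_pow_three {k : ℕ} (hk : 2 ≤ k) :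
    HasSum (fun p : ℤ × ℤ => 1 / (p.1 : ℂ) ^ k * (1 / (p.2 : ℂ) ^ k) *
        (-(Nat.factorial k : ℂ) / (2 * Real.pi * Complex.I * (-(p.1 + p.2) : ℤ)) ^ k))
      ((-(2 * Real.pi * Complex.I) ^ k / (Nat.factorial k : ℂ)) ^ 2 *
        (∫ x in (0 : ℝ)..1, bernoulliFun k x ^ 3 : ℝ)) := by
  have hB : Continuous fun x : ℝ => (bernoulliFun k x : ℂ) :=
    Complex.continuous_ofReal.comp (continuous_bernoulliFun k)
  have hcont (n : ℤ) : Continuous fun x : ℝ => fourier n (x : UnitAddCircle) :=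
    (map_continuous (fourier n)).comp (AddCircle.continuous_mk' _)
  set c : ℤ × ℤ → ℂ := fun p => 1 / (p.1 : ℂ) ^ k * (1 / (p.2 : ℂ) ^ k) with hc
  have hs : Summable fun p => ‖c p‖ :=
    Summable.mul_norm (f := fun n : ℤ => 1 / (n : ℂ) ^ k) (g := fun n : ℤ => 1 / (n : ℂ) ^ k)
      (summable_norm_one_div_int_pow hk) (summable_norm_one_div_int_pow hk)
  have hF (p : ℤ × ℤ) : Continuous fun x : ℝ =>
      c p * (fourier (p.1 + p.2) (x : UnitAddCircle) * (bernoulliFun k x : ℂ)) :=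
    continuous_const.mul ((hcont _).mul hB)
  have hnorm (p : ℤ × ℤ) (x : ℝ) :
      ‖c p * (fourier (p.1 + p.2) (x : UnitAddCircle) * (bernoulliFun k x : ℂ))‖ =
        ‖c p‖ * ‖(bernoulliFun k x : ℂ)‖ := by
    rw [norm_mul, norm_mul (fourier _ _), norm_fourier_apply, one_mul]
  have hint : IntervalIntegrable (fun x : ℝ => ∑' p, ‖c p‖ * ‖(bernoulliFun k x : ℂ)‖)
      volume 0 1 := by
    simp_rw [tsum_mul_right]
    have hcb : Continuous fun x : ℝ => (∑' p, ‖c p‖) * ‖(bernoulliFun k x : ℂ)‖ :=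
      continuous_const.mul hB.norm
    exact hcb.intervalIntegrable _ _
  have hlim (x : ℝ) (hx : x ∈ Set.Icc (0 : ℝ) 1) : HasSum
      (fun p : ℤ × ℤ => c p * (fourier (p.1 + p.2) (x : UnitAddCircle) * (bernoulliFun k x : ℂ)))
      ((-(2 * Real.pi * Complex.I) ^ k / (Nat.factorial k : ℂ)) ^ 2 *
        ((bernoulliFun k x ^ 3 : ℝ) : ℂ)) := by
    have h1 := hasSum_one_div_pow_mul_fourier_mul_bernoulliFun hk hx
    have h2 : Summable fun n : ℤ => ‖1 / (n : ℂ) ^ k * fourier n (x : UnitAddCircle)‖ := by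
      simpa only [norm_mul, norm_fourier_apply, mul_one] using summable_norm_one_div_int_pow hk
    set g : ℤ → ℂ := fun n => 1 / (n : ℂ) ^ k * fourier n (x : UnitAddCircle) with hg
    have hgg : Summable fun p : ℤ × ℤ => g p.1 * g p.2 := summable_mul_of_summable_norm h2 h2
    have h3 := (h1.mul h1 hgg).mul_right (bernoulliFun k x : ℂ)
    convert! h3 using 1
    · ext p
      simp only [hg, hc]
      rw [fourier_add]
      ring
    · push_cast
      ring
  have key := intervalIntegral.hasSum_integral_of_dominated_convergence
    (fun p x => ‖c p‖ * ‖(bernoulliFun k x : ℂ)‖)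
    (fun p => (hF p).aestronglyMeasurable)
    (fun p => .of_forall fun x _ => (hnorm p x).le)
    (.of_forall fun x _ => hs.mul_right _) hint
    (.of_forall fun x hx => hlim x
      (Set.Ioc_subset_Icc_self (by rwa [Set.uIoc_of_le zero_le_one] at hx)))
  simp_rw [intervalIntegral.integral_const_mul, intervalIntegral.integral_ofReal,
    integral_fourier_mul_bernoulliFun (by lia : k ≠ 0)] at key
  exact key

theorem hasSum_int_prod_one_div_pow_four :
    HasSum (fun p : ℤ × ℤ => 1 / ((p.1 * p.2 * (p.1 + p.2) : ℤ) : ℝ) ^ 4)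
      (6 * (19 * (2 * Real.pi) ^ 12 / (180 * (Nat.factorial 13 : ℝ)))) := by
  have h := (hasSum_integral_bernoulliFun_pow_three (k := 4) (by norm_num)).mul_left
    (-(2 * Real.pi * Complex.I) ^ 4 / (Nat.factorial 4 : ℂ))
  have hpi : (Real.pi : ℂ) ≠ 0 := Complex.ofReal_ne_zero.mpr Real.pi_ne_zero
  rw [integral_bernoulliFun_four_pow_three] at h
  rw [← Complex.hasSum_ofReal]
  convert! h using 1
  · ext p
    push_cast
    simp only [mul_pow, Complex.I_pow_four, Even.neg_pow (by decide : Even 4)]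
    have h24 : ((Nat.factorial 4 : ℕ) : ℂ) ≠ 0 := by exact_mod_cast Nat.factorial_ne_zero 4
    simp only [div_eq_mul_inv, mul_inv, one_mul]
    field_simp
  · push_cast
    simp only [mul_pow, Complex.I_pow_four, show Nat.factorial 4 = 24 from rfl]
    push_cast
    ring

/-- The six maps sending `(a, b)` to a pair of integers which, together with the negative of its
sum, is up to sign a permutation of `(a, b, -(a + b))`. -/
def signedPair : Fin 6 × (ℕ+ × ℕ+) → ℤ × ℤ := fun q =>
  ![((q.2.1 : ℤ), (q.2.2 : ℤ)), (-(q.2.1 : ℤ), -(q.2.2 : ℤ)),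
    ((q.2.1 : ℤ) + q.2.2, -(q.2.1 : ℤ)), (-((q.2.1 : ℤ) + q.2.2), (q.2.1 : ℤ)),
    (-(q.2.1 : ℤ), (q.2.1 : ℤ) + q.2.2), ((q.2.1 : ℤ), -((q.2.1 : ℤ) + q.2.2))] q.1

theorem signedPair_injective : Function.Injective signedPair := by
  rintro ⟨i, a, b⟩ ⟨j, c, d⟩ h
  have := a.pos
  have := b.pos
  have := c.pos
  have := d.pos
  fin_cases i <;> fin_cases j <;> simp [signedPair, ← PNat.coe_inj] at h ⊢ <;> lia

theorem mem_range_signedPair {m n : ℤ} (hm : m ≠ 0) (hn : n ≠ 0) (hmn : m + n ≠ 0) :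
    (m, n) ∈ Set.range signedPair := by
  have lift {z : ℤ} (hz : 0 < z) : ∃ a : ℕ+, (a : ℤ) = z :=
    ⟨⟨z.toNat, by lia⟩, by simp [hz.le]⟩
  have wit (i : Fin 6) (u v : ℤ) (hu : 0 < u) (hv : 0 < v)
      (h : ∀ a b : ℕ+, (a : ℤ) = u → (b : ℤ) = v → signedPair (i, a, b) = (m, n)) :
      (m, n) ∈ Set.range signedPair := by
    obtain ⟨a, ha⟩ := lift hu
    obtain ⟨b, hb⟩ := lift hv
    exact ⟨_, h a b ha hb⟩
  rcases lt_or_gt_of_ne hm with hm | hm <;> rcases lt_or_gt_of_ne hn with hn | hn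
  · exact wit 1 (-m) (-n) (by lia) (by lia) fun a b ha hb => by simp [signedPair, ha, hb]
  · rcases lt_or_gt_of_ne hmn with hs | hs
    · exact wit 3 n (-(m + n)) hn (by lia) fun a b ha hb => by simp [signedPair, ha, hb]
    · exact wit 4 (-m) (m + n) (by lia) hs fun a b ha hb => by simp [signedPair, ha, hb]
  · rcases lt_or_gt_of_ne hmn with hs | hs
    · exact wit 5 m (-(m + n)) hm (by lia) fun a b ha hb => by simp [signedPair, ha, hb]
    · exact wit 2 (-n) (m + n) (by lia) hs fun a b ha hb => by simp [signedPair, ha, hb]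
  · exact wit 0 m n hm hn fun a b ha hb => by simp [signedPair, ha, hb]

/-- `∑_{a,b ≥ 1} 1/(ab(a+b))⁴ = 19·(2π)¹²/(180·13!)`, the series converging absolutely. -/
theorem witten_sl3_at_four :
    (Summable fun p : ℕ+ × ℕ+ =>
      1 / (((p.1 * p.2 * (p.1 + p.2) : ℕ+) : ℕ) : ℝ) ^ 4) ∧
    (∑' p : ℕ+ × ℕ+, 1 / (((p.1 * p.2 * (p.1 + p.2) : ℕ+) : ℕ) : ℝ) ^ 4) =
      19 * (2 * Real.pi) ^ 12 / (180 * (Nat.factorial 13 : ℝ)) := by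
  have h := (signedPair_injective.hasSum_iff (fun p hp => by
    by_contra h0
    refine hp (mem_range_signedPair ?_ ?_ ?_) <;> intro h1 <;> simp [h1] at h0)).mpr
    hasSum_int_prod_one_div_pow_four
  have hval (q : Fin 6 × (ℕ+ × ℕ+)) :
      ((fun p : ℤ × ℤ => 1 / ((p.1 * p.2 * (p.1 + p.2) : ℤ) : ℝ) ^ 4) ∘ signedPair) q =
        1 / (((q.2.1 * q.2.2 * (q.2.1 + q.2.2) : ℕ+) : ℕ) : ℝ) ^ 4 := by
    obtain ⟨i, a, b⟩ := q
    simp only [Function.comp_apply]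
    congr 1
    fin_cases i <;> simp [signedPair] <;> ring
  rw [funext hval] at h
  generalize 19 * (2 * Real.pi) ^ 12 / (180 * (Nat.factorial 13 : ℝ)) = S at h ⊢
  have hs : Summable fun p : ℕ+ × ℕ+ =>
      1 / (((p.1 * p.2 * (p.1 + p.2) : ℕ+) : ℕ) : ℝ) ^ 4 :=
    h.summable.prod_factor 0
  refine ⟨hs, ?_⟩
  have h6 := h.tsum_eq
  rw [h.summable.tsum_prod, tsum_fintype] at h6
  simp only [Finset.sum_const, Finset.card_univ, Fintype.card_fin, nsmul_eq_mul] at h6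
  norm_num at h6 ⊢
  exact h6
end

section
/- Σ_{a, b, c ≥ 1} 1/(a·b·c·(a+b)·(b+c)·(a+b+c))^2 = 23·(2π)^{12}/(1680 · 13!), where the sum ranges over all triples of positive integers (a, b, c) and converges absolutely. -/
open Real

/-- Even power sums over all integers, with the term at `0` equal to `0`. -/
theorem hasSum_int_one_div_pow_even {m : ℕ} {a : ℝ} (hm : Even m) (hm0 : m ≠ 0)
    (h : HasSum (fun n : ℕ => 1 / (n : ℝ) ^ m) a) :
    HasSum (fun n : ℤ => 1 / (n : ℝ) ^ m) (2 * a) := by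
  have h1 := HasSum.of_nat_of_neg (f := fun n : ℤ => 1 / (n : ℝ) ^ m) (g := a) (g' := a)
    (by simpa using h) (by simpa [hm.neg_pow] using h)
  convert! h1 using 1
  simp [hm0]
  ring

theorem hasSum_int_one_div_pow_odd {m : ℕ} (hm : Odd m) (hm2 : 2 ≤ m) :
    HasSum (fun n : ℤ => 1 / (n : ℝ) ^ m) 0 := by
  have h : HasSum (fun n : ℕ => 1 / (n : ℝ) ^ m) (∑' n : ℕ, 1 / (n : ℝ) ^ m) :=
    (Real.summable_one_div_nat_pow.2 hm2).hasSum
  have h1 := HasSum.of_nat_of_neg (f := fun n : ℤ => 1 / (n : ℝ) ^ m)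
    (by simpa using h) (by simpa [hm.neg_pow, neg_div, inv_neg] using h.neg)
  convert! h1 using 1
  simp [show m ≠ 0 by omega]

theorem bernoulli_values :
    bernoulli 6 = 1 / 42 ∧ bernoulli 8 = -1 / 30 ∧ bernoulli 10 = 5 / 66 ∧
      bernoulli 12 = -691 / 2730 := by
  have h5 : bernoulli' 5 = 0 := bernoulli'_eq_zero_of_odd (by decide) (by norm_num)
  have h7 : bernoulli' 7 = 0 := bernoulli'_eq_zero_of_odd (by decide) (by norm_num)
  have h9 : bernoulli' 9 = 0 := bernoulli'_eq_zero_of_odd (by decide) (by norm_num)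
  have h11 : bernoulli' 11 = 0 := bernoulli'_eq_zero_of_odd (by decide) (by norm_num)
  have h6 : bernoulli' 6 = 1 / 42 := by
    rw [bernoulli'_def]
    norm_num [Finset.sum_range_succ, h5, Nat.choose]
  have h8 : bernoulli' 8 = -1 / 30 := by
    rw [bernoulli'_def]
    norm_num [Finset.sum_range_succ, h5, h6, h7, Nat.choose]
  have h10 : bernoulli' 10 = 5 / 66 := by
    rw [bernoulli'_def]
    norm_num [Finset.sum_range_succ, h5, h6, h7, h8, h9, Nat.choose]
  have h12 : bernoulli' 12 = -691 / 2730 := by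
    rw [bernoulli'_def]
    norm_num [Finset.sum_range_succ, h5, h6, h7, h8, h9, h10, h11, Nat.choose]
  simp [bernoulli_eq_bernoulli'_of_ne_one, h6, h8, h10, h12]

theorem hasSum_int_two : HasSum (fun n : ℤ => 1 / (n : ℝ) ^ 2) (π ^ 2 / 3) := by
  convert! hasSum_int_one_div_pow_even (by decide) (by norm_num) hasSum_zeta_two using 1
  ring

theorem hasSum_int_four : HasSum (fun n : ℤ => 1 / (n : ℝ) ^ 4) (π ^ 4 / 45) := by
  convert! hasSum_int_one_div_pow_even (by decide) (by norm_num) hasSum_zeta_four using 1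
  ring

theorem hasSum_int_six : HasSum (fun n : ℤ => 1 / (n : ℝ) ^ 6) (2 * π ^ 6 / 945) := by
  convert! hasSum_int_one_div_pow_even (by decide) (by norm_num)
    (hasSum_zeta_nat (k := 3) (by norm_num)) using 1
  norm_num [bernoulli_values, Nat.factorial]
  ring

theorem hasSum_int_eight : HasSum (fun n : ℤ => 1 / (n : ℝ) ^ 8) (π ^ 8 / 4725) := by
  convert! hasSum_int_one_div_pow_even (by decide) (by norm_num)
    (hasSum_zeta_nat (k := 4) (by norm_num)) using 1
  norm_num [bernoulli_values, Nat.factorial]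
  ring

theorem hasSum_int_ten : HasSum (fun n : ℤ => 1 / (n : ℝ) ^ 10) (2 * π ^ 10 / 93555) := by
  convert! hasSum_int_one_div_pow_even (by decide) (by norm_num)
    (hasSum_zeta_nat (k := 5) (by norm_num)) using 1
  norm_num [bernoulli_values, Nat.factorial]
  ring

theorem hasSum_int_twelve :
    HasSum (fun n : ℤ => 1 / (n : ℝ) ^ 12) (1382 * π ^ 12 / 638512875) := by
  convert! hasSum_int_one_div_pow_even (by decide) (by norm_num)
    (hasSum_zeta_nat (k := 6) (by norm_num)) using 1
  norm_num [bernoulli_values, Nat.factorial]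
  ring

theorem HasSum.int_sub_right {f : ℤ → ℝ} {a : ℝ} (h : HasSum f a) (x : ℤ) :
    HasSum (fun y => f (y - x)) a :=
  (Equiv.subRight x).hasSum_iff.2 h

theorem hasSum_int_one_div_pow_sub {m : ℕ} {a : ℝ}
    (h : HasSum (fun n : ℤ => 1 / (n : ℝ) ^ m) a) (x : ℤ) :
    HasSum (fun n : ℤ => 1 / ((n : ℝ) - x) ^ m) a := by
  simpa using h.int_sub_right x

theorem hasSum_one_div_add_one_sub_one_div_add_two :
    HasSum (fun k : ℕ => 1 / ((k : ℝ) + 1) - 1 / ((k : ℝ) + 2)) 1 := by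
  have hnn (k : ℕ) : 0 ≤ 1 / ((k : ℝ) + 1) - 1 / ((k : ℝ) + 2) :=
    sub_nonneg.2 (one_div_le_one_div_of_le (by positivity) (by linarith))
  rw [hasSum_iff_tendsto_nat_of_nonneg hnn]
  have hsum (n : ℕ) : ∑ k ∈ Finset.range n, (1 / ((k : ℝ) + 1) - 1 / ((k : ℝ) + 2)) =
      1 - 1 / ((n : ℝ) + 1) := by
    induction n with
    | zero => simp
    | succ n ih =>
      rw [Finset.sum_range_succ, ih]
      push_cast
      ring
  simp only [hsum]
  simpa using tendsto_const_nhds.sub (tendsto_one_div_add_atTop_nhds_zero_nat (𝕜 := ℝ))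

theorem hasSum_int_one_div_sub_one_div_sub_one :
    HasSum (fun n : ℤ => 1 / (n : ℝ) - 1 / ((n : ℝ) - 1)) 0 := by
  have h := hasSum_one_div_add_one_sub_one_div_add_two.neg
  have hpos : HasSum (fun n : ℕ => 1 / ((n : ℤ) : ℝ) - 1 / (((n : ℤ) : ℝ) - 1)) 1 := by
    rw [← hasSum_nat_add_iff' 2]
    convert! h using 1
    · funext k
      push_cast
      ring
    · norm_num [Finset.sum_range_succ]
  convert! hpos.of_nat_of_neg_add_one (m' := -1)
    (f := fun n : ℤ => 1 / (n : ℝ) - 1 / ((n : ℝ) - 1)) ?_ using 1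
  · ring
  · convert! h using 1
    funext k
    push_cast
    rw [show -((k : ℝ) + 1) - 1 = -(k + 2) by ring, one_div_neg_eq_neg_one_div,
      one_div_neg_eq_neg_one_div]
    ring

/-- The telescoping sum of `1 / n - 1 / (n - x)` over all integers. -/
theorem hasSum_int_one_div_sub_one_div (x : ℤ) :
    HasSum (fun n : ℤ => 1 / (n : ℝ) - 1 / ((n : ℝ) - x)) 0 := by
  have step (y : ℤ) : HasSum (fun n : ℤ => 1 / ((n : ℝ) - y) - 1 / ((n : ℝ) - (y + 1))) 0 := by
    convert! hasSum_int_one_div_sub_one_div_sub_one.int_sub_right y using 3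
    · push_cast; ring
    · push_cast; ring
  induction x using Int.induction_on with
  | zero => simp
  | succ k ih => simpa using ih.add (step k)
  | pred k ih =>
    convert! ih.sub (step (-k - 1)) using 2
    · push_cast; ring_nf
    · simp

/-- The summand of the Witten zeta function of `𝔰𝔩₄` at `2`, as a function of the differences
`x, y, z` of three integers to a fourth one. -/
noncomputable def wittenTerm (p : (ℤ × ℤ) × ℤ) : ℝ :=
  1 / ((p.1.1 : ℝ) * p.1.2 * p.2 * (p.1.1 - p.1.2) * (p.1.2 - p.2) * (p.1.1 - p.2)) ^ 2

/-- Closed form of the sum of `wittenTerm ((x, y), z)` over `z`. -/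
noncomputable def wittenInner (p : ℤ × ℤ) : ℝ :=
  (π ^ 2 / 3 * (1 / (p.1 : ℝ) ^ 2 / p.2 ^ 2 + 1 / (p.1 : ℝ) ^ 2 / (p.2 - p.1) ^ 2
      + 1 / (p.2 : ℝ) ^ 2 / (p.2 - p.1) ^ 2)
    - ((3 / (p.1 : ℝ) ^ 2 + 3 / p.2 ^ 2 + 4 / (p.1 * p.2)) / (p.1 ^ 2 * p.2 ^ 2)
      + (3 / (p.1 : ℝ) ^ 2 + 3 / (p.2 - p.1) ^ 2 - 4 / (p.1 * (p.2 - p.1)))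
          / (p.1 ^ 2 * (p.2 - p.1) ^ 2)
      + (3 / (p.2 : ℝ) ^ 2 + 3 / (p.2 - p.1) ^ 2 + 4 / (p.2 * (p.2 - p.1)))
          / (p.2 ^ 2 * (p.2 - p.1) ^ 2)))
    / (p.1 * p.2 * (p.2 - p.1)) ^ 2

theorem hasSum_wittenTerm_right (p : ℤ × ℤ) :
    HasSum (fun z => wittenTerm (p, z)) (wittenInner p) := by
  obtain ⟨x, y⟩ := p
  by_cases hx : x = 0
  · simp [wittenTerm, wittenInner, hx, hasSum_zero]
  by_cases hy : y = 0
  · simp [wittenTerm, wittenInner, hy, hasSum_zero]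
  by_cases hxy : y = x
  · simp [wittenTerm, wittenInner, hxy, hasSum_zero]
  have hx' : (x : ℝ) ≠ 0 := by exact_mod_cast hx
  have hy' : (y : ℝ) ≠ 0 := by exact_mod_cast hy
  have hw : (y : ℝ) - x ≠ 0 := sub_ne_zero.2 (by exact_mod_cast hxy)
  have hw' : (x : ℝ) - y ≠ 0 := sub_ne_zero.2 (by exact_mod_cast Ne.symm hxy)
  set A₀ : ℝ := 1 / (x ^ 2 * y ^ 2) with hA₀
  set A₁ : ℝ := 1 / (x ^ 2 * (y - x) ^ 2) with hA₁
  set A₂ : ℝ := 1 / (y ^ 2 * (y - x) ^ 2) with hA₂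
  set B₁ : ℝ := 2 * A₁ * (1 / x - 1 / (y - x)) with hB₁
  set B₂ : ℝ := 2 * A₂ * (1 / y + 1 / (y - x)) with hB₂
  set R : ℤ → ℝ := fun z => A₀ * (1 / (z : ℝ) ^ 2) + A₁ * (1 / ((z : ℝ) - x) ^ 2)
    + A₂ * (1 / ((z : ℝ) - y) ^ 2) + B₁ * (1 / (z : ℝ) - 1 / ((z : ℝ) - x))
    + B₂ * (1 / (z : ℝ) - 1 / ((z : ℝ) - y)) with hR
  have hRsum : HasSum R (A₀ * (π ^ 2 / 3) + A₁ * (π ^ 2 / 3) + A₂ * (π ^ 2 / 3) + B₁ * 0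
      + B₂ * 0) :=
    ((((hasSum_int_two.mul_left A₀).add
      ((hasSum_int_one_div_pow_sub hasSum_int_two x).mul_left A₁)).add
      ((hasSum_int_one_div_pow_sub hasSum_int_two y).mul_left A₂)).add
      ((hasSum_int_one_div_sub_one_div x).mul_left B₁)).add
      ((hasSum_int_one_div_sub_one_div y).mul_left B₂)
  have key := (((hRsum.sub (hasSum_ite_eq 0 (R 0))).sub (hasSum_ite_eq x (R x))).sub
    (hasSum_ite_eq y (R y))).mul_left (1 / ((x : ℝ) * y * (y - x)) ^ 2)
  convert! key using 1
  · funext z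
    by_cases hz : z = 0
    · simp [hz, wittenTerm, Ne.symm hx, Ne.symm hy]
    by_cases hzx : z = x
    · simp [hzx, wittenTerm, hx, Ne.symm hxy]
    by_cases hzy : z = y
    · simp [hzy, wittenTerm, hy, hxy]
    have hz' : (z : ℝ) ≠ 0 := by exact_mod_cast hz
    have hzx' : (z : ℝ) - x ≠ 0 := sub_ne_zero.2 (by exact_mod_cast hzx)
    have hzy' : (z : ℝ) - y ≠ 0 := sub_ne_zero.2 (by exact_mod_cast hzy)
    have hzx'' : (x : ℝ) - z ≠ 0 := sub_ne_zero.2 (by exact_mod_cast Ne.symm hzx)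
    have hzy'' : (y : ℝ) - z ≠ 0 := sub_ne_zero.2 (by exact_mod_cast Ne.symm hzy)
    simp only [hz, hzx, hzy, if_false, sub_zero, wittenTerm, hR, hB₁, hB₂, hA₀, hA₁, hA₂]
    rw [show (x : ℝ) - y = -(y - x) by ring, show (x : ℝ) - z = -(z - x) by ring,
      show (y : ℝ) - z = -(z - y) by ring]
    field_simp
    ring
  · have h0 : R 0 = A₀ * 0 + A₁ / x ^ 2 + A₂ / y ^ 2 + B₁ / x + B₂ / y := by
      simp [hR, div_eq_mul_inv]
    have h1 : R x = A₀ / x ^ 2 + A₂ / (y - x) ^ 2 + B₁ / x + B₂ * (1 / x + 1 / (y - x)) := by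
      simp only [hR, sub_self]
      rw [show (x : ℝ) - y = -(y - x) by ring]
      field_simp
      ring
    have h2 : R y = A₀ / y ^ 2 + A₁ / (y - x) ^ 2 + B₁ * (1 / y - 1 / (y - x)) + B₂ / y := by
      simp only [hR, sub_self]
      field_simp
      ring
    simp only [h0, h1, h2, wittenInner, hB₁, hB₂, hA₀, hA₁, hA₂]
    field_simp
    ring

/-- Closed form of the sum of `wittenTerm ((x, y), z)` over `y` and `z`. -/
noncomputable def wittenOuter (x : ℤ) : ℝ :=
  π ^ 2 / 3 * (-100 * (1 / (x : ℝ) ^ 10) + 28 * (π ^ 2 / 3) * (1 / (x : ℝ) ^ 8)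
      + 4 * (π ^ 4 / 45) * (1 / (x : ℝ) ^ 6))
    + (678 * (1 / (x : ℝ) ^ 12) - 156 * (π ^ 2 / 3) * (1 / (x : ℝ) ^ 10)
      - 66 * (π ^ 4 / 45) * (1 / (x : ℝ) ^ 8) - 12 * (2 * π ^ 6 / 945) * (1 / (x : ℝ) ^ 6))

theorem hasSum_wittenOuter :
    HasSum wittenOuter (24 * (23 * (2 * π) ^ 12 / (1680 * (Nat.factorial 13 : ℝ)))) := by
  convert! ((((hasSum_int_ten.mul_left (-100)).add
    (hasSum_int_eight.mul_left (28 * (π ^ 2 / 3)))).add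
    (hasSum_int_six.mul_left (4 * (π ^ 4 / 45)))).mul_left (π ^ 2 / 3)).add
    ((((hasSum_int_twelve.mul_left 678).sub (hasSum_int_ten.mul_left (156 * (π ^ 2 / 3)))).sub
    (hasSum_int_eight.mul_left (66 * (π ^ 4 / 45)))).sub
    (hasSum_int_six.mul_left (12 * (2 * π ^ 6 / 945)))) using 1
  norm_num [Nat.factorial]
  ring

theorem hasSum_wittenInner_right (x : ℤ) :
    HasSum (fun y => wittenInner (x, y)) (wittenOuter x) := by
  by_cases hx : x = 0
  · simp [wittenInner, wittenOuter, hx, hasSum_zero]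
  have hx' : (x : ℝ) ≠ 0 := by exact_mod_cast hx
  set R : ℤ → ℝ := fun y =>
    (π ^ 2 / 3 * (28 / x ^ 9) - 156 / x ^ 11) * (1 / (y : ℝ) - 1 / ((y : ℝ) - x))
    + (π ^ 2 / 3 * (14 / x ^ 8) - 78 / x ^ 10) * (1 / (y : ℝ) ^ 2 + 1 / ((y : ℝ) - x) ^ 2)
    + (π ^ 2 / 3 * (6 / x ^ 7) - 48 / x ^ 9) * (1 / (y : ℝ) ^ 3 - 1 / ((y : ℝ) - x) ^ 3)
    + (π ^ 2 / 3 * (2 / x ^ 6) - 33 / x ^ 8) * (1 / (y : ℝ) ^ 4 + 1 / ((y : ℝ) - x) ^ 4)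
    + (-18 / x ^ 7) * (1 / (y : ℝ) ^ 5 - 1 / ((y : ℝ) - x) ^ 5)
    + (-6 / x ^ 6) * (1 / (y : ℝ) ^ 6 + 1 / ((y : ℝ) - x) ^ 6) with hR
  have h3 := hasSum_int_one_div_pow_odd (m := 3) (by decide) (by norm_num)
  have h5 := hasSum_int_one_div_pow_odd (m := 5) (by decide) (by norm_num)
  have hRsum := (((((hasSum_int_one_div_sub_one_div x).mul_left
      (π ^ 2 / 3 * (28 / x ^ 9) - 156 / x ^ 11)).add
    ((hasSum_int_two.add (hasSum_int_one_div_pow_sub hasSum_int_two x)).mul_left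
      (π ^ 2 / 3 * (14 / x ^ 8) - 78 / x ^ 10))).add
    ((h3.sub (hasSum_int_one_div_pow_sub h3 x)).mul_left
      (π ^ 2 / 3 * (6 / x ^ 7) - 48 / x ^ 9))).add
    ((hasSum_int_four.add (hasSum_int_one_div_pow_sub hasSum_int_four x)).mul_left
      (π ^ 2 / 3 * (2 / x ^ 6) - 33 / x ^ 8))).add
    ((h5.sub (hasSum_int_one_div_pow_sub h5 x)).mul_left (-18 / (x : ℝ) ^ 7)) |>.add
    ((hasSum_int_six.add (hasSum_int_one_div_pow_sub hasSum_int_six x)).mul_left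
      (-6 / (x : ℝ) ^ 6))
  have key := (hRsum.sub (hasSum_ite_eq 0 (R 0))).sub (hasSum_ite_eq x (R x))
  convert! key using 1
  · funext y
    by_cases hy : y = 0
    · simp [hy, wittenInner, Ne.symm hx, hR]
    by_cases hxy : y = x
    · simp [hxy, wittenInner, hx, hR]
    have hy' : (y : ℝ) ≠ 0 := by exact_mod_cast hy
    have hw : (y : ℝ) - x ≠ 0 := sub_ne_zero.2 (by exact_mod_cast hxy)
    simp only [hy, hxy, if_false, sub_zero, wittenInner]
    field_simp
    ring
  · have h0 : R 0 = (π ^ 2 / 3 * 50 / x ^ 10 - 339 / x ^ 12) := by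
      simp only [hR, Int.cast_zero, zero_sub]
      field_simp
      ring
    have h1 : R x = (π ^ 2 / 3 * 50 / x ^ 10 - 339 / x ^ 12) := by
      simp only [hR, sub_self]
      field_simp
      ring
    rw [h0, h1]
    simp only [wittenOuter]
    field_simp
    ring

theorem one_div_int_sq_mul_sq_le (a b : ℤ) : 1 / ((a : ℝ) * b) ^ 2 ≤ 1 / (a : ℝ) ^ 2 := by
  by_cases ha : a = 0
  · simp [ha]
  by_cases hb : b = 0
  · simp [hb]; positivity
  have hb1 : (1 : ℝ) ≤ (b : ℝ) ^ 2 := by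
    exact_mod_cast Order.one_le_iff_pos.2 (show 0 < b ^ 2 by positivity)
  have ha' : (0 : ℝ) < (a : ℝ) ^ 2 := by positivity
  rw [mul_pow]
  exact one_div_le_one_div_of_le ha' (by nlinarith)

theorem summable_wittenTerm : Summable wittenTerm := by
  have h := hasSum_int_two.summable
  have hnn : (0 : ℤ → ℝ) ≤ fun n : ℤ => 1 / (n : ℝ) ^ 2 := fun n => by
    simp only [Pi.zero_apply]; positivity
  have h2 := h.mul_of_nonneg h hnn hnn
  have h3 := h2.mul_of_nonneg h (fun p => mul_nonneg (hnn _) (hnn _)) hnn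
  refine Summable.of_nonneg_of_le (fun p => by unfold wittenTerm; positivity) (fun p => ?_) h3
  have := one_div_int_sq_mul_sq_le (p.1.1 * p.1.2 * p.2)
    ((p.1.1 - p.1.2) * (p.1.2 - p.2) * (p.1.1 - p.2))
  push_cast at this
  calc wittenTerm p = _ := by rw [wittenTerm, ← mul_assoc, ← mul_assoc]
    _ ≤ _ := this
    _ = _ := by ring

theorem hasSum_wittenTerm :
    HasSum wittenTerm (24 * (23 * (2 * π) ^ 12 / (1680 * (Nat.factorial 13 : ℝ)))) := by
  have h1 := summable_wittenTerm.hasSum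
  have h2 := h1.prod_fiberwise hasSum_wittenTerm_right
  have h3 := h2.prod_fiberwise hasSum_wittenInner_right
  rw [← h3.unique hasSum_wittenOuter]
  exact h1

theorem wittenTerm_ne_zero {x y z : ℤ} (h : wittenTerm ((x, y), z) ≠ 0) :
    x ≠ 0 ∧ y ≠ 0 ∧ z ≠ 0 ∧ x ≠ y ∧ y ≠ z ∧ x ≠ z := by
  refine ⟨?_, ?_, ?_, ?_, ?_, ?_⟩ <;> rintro rfl <;> simp [wittenTerm] at h

theorem HasSum.comp_involutive {α : Type*} {f : α → ℝ} {a : ℝ} (h : HasSum f a) (g : α → α)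
    (hg : Function.Involutive g) : HasSum (fun p => f (g p)) a :=
  (hg.toPerm g).hasSum_iff.2 h

/-- The full sum is `24` times the sum over the Weyl chamber `0 < x < y < z`. -/
theorem hasSum_wittenTerm_of_chamber {S : ℝ}
    (h : HasSum (fun p : (ℤ × ℤ) × ℤ =>
      if 0 < p.1.1 ∧ p.1.1 < p.1.2 ∧ p.1.2 < p.2 then wittenTerm p else 0) S) :
    HasSum wittenTerm (24 * S) := by
  have inv1 (x y z : ℤ) : wittenTerm ((x, z), y) = wittenTerm ((x, y), z) := by
    simp only [wittenTerm]; congr 1; ring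
  have inv2 (x y z : ℤ) : wittenTerm ((y, x), z) = wittenTerm ((x, y), z) := by
    simp only [wittenTerm]; congr 1; ring
  have inv3 (x y z : ℤ) : wittenTerm ((z, y), x) = wittenTerm ((x, y), z) := by
    simp only [wittenTerm]; congr 1; ring
  have inv4 (x y z : ℤ) : wittenTerm ((-x, y - x), z - x) = wittenTerm ((x, y), z) := by
    simp only [wittenTerm]; push_cast; congr 1; ring
  have inv5 (x y z : ℤ) : wittenTerm ((x - y, -y), z - y) = wittenTerm ((x, y), z) := by
    simp only [wittenTerm]; push_cast; congr 1; ring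
  have inv6 (x y z : ℤ) : wittenTerm ((x - z, y - z), -z) = wittenTerm ((x, y), z) := by
    simp only [wittenTerm]; push_cast; congr 1; ring
  have h1 : HasSum (fun p : (ℤ × ℤ) × ℤ =>
      if 0 < p.1.1 ∧ p.1.1 < p.1.2 ∧ p.1.1 < p.2 then wittenTerm p else 0) (S + S) := by
    convert! h.add
        (h.comp_involutive (fun p => ((p.1.1, p.2), p.1.2)) (fun p => by ext <;> simp)) using 1
    funext ⟨⟨x, y⟩, z⟩
    simp only [inv1]
    by_cases h0 : wittenTerm ((x, y), z) = 0
    · simp [h0]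
    obtain ⟨hx, hy, hz, hxy, hyz, hxz⟩ := wittenTerm_ne_zero h0
    split_ifs <;> first | omega | simp
  have h2 : HasSum (fun p : (ℤ × ℤ) × ℤ =>
      if 0 < p.1.1 ∧ 0 < p.1.2 ∧ 0 < p.2 then wittenTerm p else 0)
      ((S + S) + (S + S) + (S + S)) := by
    convert! (h1.add
        (h1.comp_involutive (fun p => ((p.1.2, p.1.1), p.2)) (fun p => by ext <;> simp))).add
        (h1.comp_involutive (fun p => ((p.2, p.1.2), p.1.1)) (fun p => by ext <;> simp)) using 1
    funext ⟨⟨x, y⟩, z⟩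
    simp only [inv2 x y z, inv3 x y z]
    by_cases h0 : wittenTerm ((x, y), z) = 0
    · simp [h0]
    obtain ⟨hx, hy, hz, hxy, hyz, hxz⟩ := wittenTerm_ne_zero h0
    split_ifs <;> first | omega | simp
  have hx := h2.comp_involutive (fun p => ((-p.1.1, p.1.2 - p.1.1), p.2 - p.1.1))
    (fun p => by ext <;> simp)
  have hy := h2.comp_involutive (fun p => ((p.1.1 - p.1.2, -p.1.2), p.2 - p.1.2))
    (fun p => by ext <;> simp)
  have hz := h2.comp_involutive (fun p => ((p.1.1 - p.2, p.1.2 - p.2), -p.2))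
    (fun p => by ext <;> simp)
  convert! ((h2.add hx).add hy).add hz using 1
  · funext ⟨⟨x, y⟩, z⟩
    simp only [inv4, inv5, inv6]
    by_cases h0 : wittenTerm ((x, y), z) = 0
    · simp [h0]
    obtain ⟨hx, hy, hz, hxy, hyz, hxz⟩ := wittenTerm_ne_zero h0
    split_ifs <;> first | omega | simp
  · ring

/-- The partial sums of a triple of positive integers. -/
def chamberMap (p : ℕ+ × ℕ+ × ℕ+) : (ℤ × ℤ) × ℤ :=
  (((p.1 : ℕ), (p.1 : ℕ) + (p.2.1 : ℕ)), (p.1 : ℕ) + (p.2.1 : ℕ) + (p.2.2 : ℕ))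

theorem chamberMap_injective : Function.Injective chamberMap := by
  rintro ⟨a, b, c⟩ ⟨a', b', c'⟩ h
  simp only [chamberMap, Prod.mk.injEq] at h
  simp only [Prod.mk.injEq, ← PNat.coe_inj]
  omega

theorem wittenTerm_chamberMap (p : ℕ+ × ℕ+ × ℕ+) :
    wittenTerm (chamberMap p) =
      1 / (((p.1 * p.2.1 * p.2.2 * (p.1 + p.2.1) * (p.2.1 + p.2.2) *
        (p.1 + p.2.1 + p.2.2) : ℕ+) : ℕ) : ℝ) ^ 2 := by
  simp only [wittenTerm, chamberMap]
  push_cast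
  congr 1
  ring

/-- `∑_{a,b,c ≥ 1} 1/(abc(a+b)(b+c)(a+b+c))² = 23·(2π)¹²/(1680·13!)`,
the series converging absolutely. -/
theorem witten_sl4_at_two :
    (Summable fun p : ℕ+ × ℕ+ × ℕ+ =>
      1 / (((p.1 * p.2.1 * p.2.2 * (p.1 + p.2.1) * (p.2.1 + p.2.2) *
        (p.1 + p.2.1 + p.2.2) : ℕ+) : ℕ) : ℝ) ^ 2) ∧
    (∑' p : ℕ+ × ℕ+ × ℕ+,
        1 / (((p.1 * p.2.1 * p.2.2 * (p.1 + p.2.1) * (p.2.1 + p.2.2) *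
          (p.1 + p.2.1 + p.2.2) : ℕ+) : ℕ) : ℝ) ^ 2) =
      23 * (2 * Real.pi) ^ 12 / (1680 * (Nat.factorial 13 : ℝ)) := by
  simp only [← wittenTerm_chamberMap]
  have hs : Summable fun p => wittenTerm (chamberMap p) :=
    summable_wittenTerm.comp_injective chamberMap_injective
  refine ⟨hs, ?_⟩
  have hchamber (p : ℕ+ × ℕ+ × ℕ+) : 0 < (chamberMap p).1.1 ∧
      (chamberMap p).1.1 < (chamberMap p).1.2 ∧ (chamberMap p).1.2 < (chamberMap p).2 := by
    have h1 := p.1.pos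
    have h2 := p.2.1.pos
    have h3 := p.2.2.pos
    simp only [chamberMap]
    omega
  have h := (chamberMap_injective.hasSum_iff (f := fun p : (ℤ × ℤ) × ℤ =>
      if 0 < p.1.1 ∧ p.1.1 < p.1.2 ∧ p.1.2 < p.2 then wittenTerm p else 0) (by
    rintro ⟨⟨x, y⟩, z⟩ hp
    refine if_neg fun ⟨hx, hxy, hyz⟩ => hp ?_
    simp only at hx hxy hyz
    refine ⟨(⟨x.toNat, by omega⟩, ⟨(y - x).toNat, by omega⟩, ⟨(z - y).toNat, by omega⟩), ?_⟩
    simp only [chamberMap, PNat.mk_coe, Prod.mk.injEq]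
    omega)).1 (by simpa only [Function.comp_def, hchamber, and_self, if_true] using hs.hasSum)
  linarith [(hasSum_wittenTerm_of_chamber h).unique hasSum_wittenTerm]
end
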